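/- Uniform time decay of the high-frequency part of the localized kernel (intermediate estimate in the proof of Lemma 3.4): there exists C>0 such that for every integer k ≥ 0, each of the three choices (ψ₁,ψ₂,ψ₃) = (δ_k,p_k,p_k), (p_k,δ_k,p_k) or (p_k,p_k,δ_k), every t ∈ (0,1] and every x̄ ∈ ℝ³, |I_k^1(t,x̄)| ≤ C t^{-4/3}, where I_k^1(t,x̄) = ∫_{ℝ³} e^{i(x̄·ξ̄ + tω(ξ̄))} ψ₁(ξ)(1−p(ξ)) ψ₂(η) ψ₃(μ) dξ̄. -/

import Mathlib

open MeasureTheory Real Filter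
open scoped ENNReal

noncomputable section

/-- Euclidean dot product on ℝ³ (realized as ℝ × ℝ × ℝ). -/
def dot3 (a b : ℝ × ℝ × ℝ) : ℝ := a.1 * b.1 + a.2.1 * b.2.1 + a.2.2 * b.2.2

/-- Euclidean norm on ℝ³. -/
def en3 (ξ : ℝ × ℝ × ℝ) : ℝ := Real.sqrt (dot3 ξ ξ)

/-- The Zakharov–Kuznetsov dispersion relation ω(ξ,η,μ) = ξ(ξ²+η²+μ²). -/
def omega3 (ξ : ℝ × ℝ × ℝ) : ℝ := ξ.1 * (ξ.1 ^ 2 + ξ.2.1 ^ 2 + ξ.2.2 ^ 2)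

/-- Fourier transform on ℝ³, with normalization (2π)⁻³ ∫ e^{-i x·ξ} φ(x) dx. -/
def FT3 (φ : ℝ × ℝ × ℝ → ℂ) (ξ : ℝ × ℝ × ℝ) : ℂ :=
  ((((2 * π) ^ 3)⁻¹ : ℝ) : ℂ) * ∫ x : ℝ × ℝ × ℝ, Complex.exp (-Complex.I * (dot3 x ξ : ℂ)) * φ x

/-- Inverse Fourier transform on ℝ³: ∫ e^{i x·ξ} g(ξ) dξ. -/
def invFT3 (g : ℝ × ℝ × ℝ → ℂ) (x : ℝ × ℝ × ℝ) : ℂ :=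
  ∫ ξ : ℝ × ℝ × ℝ, Complex.exp (Complex.I * (dot3 x ξ : ℂ)) * g ξ

/-- The free Zakharov–Kuznetsov evolution U(t)φ(x̄) = ∫ e^{i(x̄·ξ̄ + tω(ξ̄))} φ̂(ξ̄) dξ̄. -/
def U3 (φ : ℝ × ℝ × ℝ → ℂ) (t : ℝ) (x : ℝ × ℝ × ℝ) : ℂ :=
  ∫ ξ : ℝ × ℝ × ℝ, Complex.exp (Complex.I * ((dot3 x ξ + t * omega3 ξ : ℝ) : ℂ)) * FT3 φ ξ

/-- L² norm on ℝ³. -/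
def L2norm3 (φ : ℝ × ℝ × ℝ → ℂ) : ℝ := Real.sqrt (∫ x : ℝ × ℝ × ℝ, ‖φ x‖ ^ 2)

/-- j-th coordinate of a point of ℝ³. -/
def coord3 (j : Fin 3) (ξ : ℝ × ℝ × ℝ) : ℝ := ![ξ.1, ξ.2.1, ξ.2.2] j

/-- Littlewood–Paley ring cutoff δ_k(ξ̄) = p(2^{-k-1}ξ̄) − p(2^{-k}ξ̄) on ℝ³. -/
def delta3 (p : ℝ × ℝ × ℝ → ℝ) (k : ℤ) (ξ : ℝ × ℝ × ℝ) : ℝ :=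
  p ((2:ℝ) ^ (-k-1) • ξ) - p ((2:ℝ) ^ (-k) • ξ)

/-- 1D rescaled cutoff p_k(ξ) = p(2^{-k}ξ). -/
def pk1 (p : ℝ → ℝ) (k : ℤ) (ξ : ℝ) : ℝ := p ((2:ℝ) ^ (-k) * ξ)

/-- 1D ring cutoff δ_k(ξ) = p(2^{-k-1}ξ) − p(2^{-k}ξ). -/
def dk1 (p : ℝ → ℝ) (k : ℤ) (ξ : ℝ) : ℝ := p ((2:ℝ) ^ (-k-1) * ξ) - p ((2:ℝ) ^ (-k) * ξ)

/-- Oscillatory integral I with three 1D symbols: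
I(t,x̄) = ∫ e^{i(x̄·ξ̄+tω(ξ̄))} ψ₁(ξ)ψ₂(η)ψ₃(μ) dξ̄. -/
def oscI (ψ₁ ψ₂ ψ₃ : ℝ → ℝ) (t : ℝ) (x : ℝ × ℝ × ℝ) : ℂ :=
  ∫ ξ : ℝ × ℝ × ℝ, Complex.exp (Complex.I * ((dot3 x ξ + t * omega3 ξ : ℝ) : ℂ)) *
    ((ψ₁ ξ.1 * ψ₂ ξ.2.1 * ψ₃ ξ.2.2 : ℝ) : ℂ)

theorem norm_cexp_I_mul_ofReal (x : ℝ) : ‖Complex.exp (Complex.I * x)‖ = 1 := by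
  rw [mul_comm, Complex.norm_exp_ofReal_mul_I]

open Complex in
/-- Van der Corput's first-derivative test for a phase with monotone derivative `f`. -/
theorem norm_integral_cexp_le_of_le_abs_deriv {φ f g : ℝ → ℝ} {a b r : ℝ} (hab : a ≤ b)
    (hr : 0 < r) (hφ : ∀ x ∈ Set.Icc a b, HasDerivAt φ (f x) x)
    (hf : ∀ x ∈ Set.Icc a b, HasDerivAt f (g x) x) (hg : ContinuousOn g (Set.Icc a b))
    (hg0 : ∀ x ∈ Set.Icc a b, 0 ≤ g x) (hfr : ∀ x ∈ Set.Icc a b, r ≤ |f x|) :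
    ‖∫ x in a..b, cexp (I * φ x)‖ ≤ 4 / r := by
  have hf0 : ∀ x ∈ Set.Icc a b, f x ≠ 0 := fun x hx h => by
    have := hfr x hx
    rw [h, abs_zero] at this
    linarith
  have hφc : ContinuousOn φ (Set.Icc a b) := fun x hx => (hφ x hx).continuousAt.continuousWithinAt
  have hfc : ContinuousOn f (Set.Icc a b) := fun x hx => (hf x hx).continuousAt.continuousWithinAt
  have hec : ContinuousOn (fun x => cexp (I * φ x)) (Set.Icc a b) := by fun_prop
  have hqc : ContinuousOn (fun x => g x / f x ^ 2) (Set.Icc a b) :=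
    hg.div (hfc.pow 2) fun x hx => pow_ne_zero 2 (hf0 x hx)
  have hinv : ∀ x ∈ Set.Icc a b, |1 / f x| ≤ 1 / r := fun x hx => by
    rw [abs_div, abs_one]
    exact one_div_le_one_div_of_le hr (hfr x hx)
  have hrest : ContinuousOn (fun x => cexp (I * φ x) * I * ((g x / f x ^ 2 : ℝ) : ℂ))
      (Set.Icc a b) := by fun_prop
  have hI : ∫ x in a..b, (cexp (I * φ x) + cexp (I * φ x) * I * ((g x / f x ^ 2 : ℝ) : ℂ))
      = -I * cexp (I * φ b) * ((1 / f b : ℝ) : ℂ) - -I * cexp (I * φ a) * ((1 / f a : ℝ) : ℂ) := by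
    refine intervalIntegral.integral_eq_sub_of_hasDerivAt
      (f := fun x => -I * cexp (I * φ x) * ((1 / f x : ℝ) : ℂ)) (fun x hx => ?_) ?_
    · rw [Set.uIcc_of_le hab] at hx
      have h1 : HasDerivAt (fun x : ℝ => cexp (I * φ x)) (cexp (I * φ x) * (I * f x)) x :=
        ((hφ x hx).ofReal_comp.const_mul I).cexp
      have h2 : HasDerivAt (fun x : ℝ => ((1 / f x : ℝ) : ℂ)) ((-g x / f x ^ 2 : ℝ) : ℂ) x := by
        have := ((hf x hx).fun_inv (hf0 x hx)).ofReal_comp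
        simpa using this
      have hfx : (f x : ℂ) ≠ 0 := by exact_mod_cast hf0 x hx
      refine ((h1.const_mul (-I)).fun_mul h2).congr_deriv ?_
      push_cast
      field_simp
      linear_combination -(f x : ℂ) ^ 2 * I_sq
    · apply ContinuousOn.intervalIntegrable
      rw [Set.uIcc_of_le hab]
      exact hec.add hrest
  have hii : ∀ {h : ℝ → ℂ}, ContinuousOn h (Set.Icc a b) → IntervalIntegrable h volume a b :=
    fun hh => ContinuousOn.intervalIntegrable (by rwa [Set.uIcc_of_le hab])
  rw [intervalIntegral.integral_add (hii hec) (hii hrest)] at hI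
  have hJ : ∫ x in a..b, g x / f x ^ 2 = -(1 / f b) - -(1 / f a) := by
    refine intervalIntegral.integral_eq_sub_of_hasDerivAt (f := fun x => -(1 / f x))
      (fun x hx => ?_) ?_
    · rw [Set.uIcc_of_le hab] at hx
      have := ((hf x hx).fun_inv (hf0 x hx)).fun_neg
      simpa [neg_div] using this
    · apply ContinuousOn.intervalIntegrable
      rwa [Set.uIcc_of_le hab]
  have hrb : ‖∫ x in a..b, cexp (I * φ x) * I * ((g x / f x ^ 2 : ℝ) : ℂ)‖ ≤ 2 / r := by
    calc _ ≤ ∫ x in a..b, g x / f x ^ 2 := by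
          refine intervalIntegral.norm_integral_le_of_norm_le hab
            (ae_of_all _ fun x hx => ?_) ?_
          · rw [norm_mul, norm_mul, norm_cexp_I_mul_ofReal, norm_I, norm_real,
              Real.norm_eq_abs, abs_of_nonneg]
            · simp
            · exact div_nonneg (hg0 x (Set.Ioc_subset_Icc_self hx)) (sq_nonneg _)
          · apply ContinuousOn.intervalIntegrable
            rwa [Set.uIcc_of_le hab]
      _ ≤ 2 / r := by
          rw [hJ]
          have h1 := (abs_le.mp (hinv a (Set.left_mem_Icc.mpr hab))).2
          have h2 := (abs_le.mp (hinv b (Set.right_mem_Icc.mpr hab))).1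
          rw [show 2 / r = 1 / r + 1 / r by ring]
          linarith
  have hbd : ∀ x ∈ Set.Icc a b, ‖-I * cexp (I * φ x) * ((1 / f x : ℝ) : ℂ)‖ ≤ 1 / r :=
    fun x hx => by
      rw [norm_mul, norm_mul, norm_cexp_I_mul_ofReal, norm_neg, norm_I, norm_real, Real.norm_eq_abs, one_mul,
        one_mul]
      exact hinv x hx
  rw [eq_sub_of_add_eq hI]
  refine (norm_sub_le _ _).trans ?_
  have := norm_sub_le (-I * cexp (I * φ b) * ((1 / f b : ℝ) : ℂ))
    (-I * cexp (I * φ a) * ((1 / f a : ℝ) : ℂ))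
  have h1 := hbd a (Set.left_mem_Icc.mpr hab)
  have h2 := hbd b (Set.right_mem_Icc.mpr hab)
  rw [show 4 / r = 1 / r + 1 / r + 2 / r by ring]
  linarith

/-- A function with derivative at least `r` on an interval moves away from its zero (or from the
endpoint closest to it) at speed `r`. -/
theorem exists_forall_mul_sub_le_of_le_deriv {f g : ℝ → ℝ} {a b r : ℝ} (hab : a ≤ b)
    (hf : ∀ x ∈ Set.Icc a b, HasDerivAt f (g x) x) (hg : ∀ x ∈ Set.Icc a b, r ≤ g x) :
    ∃ c ∈ Set.Icc a b, (∀ x ∈ Set.Ioc c b, r * (x - c) ≤ f x) ∧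
      ∀ x ∈ Set.Ico a c, f x ≤ -(r * (c - x)) := by
  have hfc : ContinuousOn f (Set.Icc a b) := fun x hx => (hf x hx).continuousAt.continuousWithinAt
  have hmv : ∀ x ∈ Set.Icc a b, ∀ y ∈ Set.Icc a b, x ≤ y → r * (y - x) ≤ f y - f x := by
    refine (convex_Icc a b).mul_sub_le_image_sub_of_le_deriv hfc (fun x hx => ?_) fun x hx => ?_
    · exact (hf x (interior_subset hx)).differentiableAt.differentiableWithinAt
    · rw [(hf x (interior_subset hx)).deriv]
      exact hg x (interior_subset hx)
  have ha := Set.left_mem_Icc.mpr hab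
  have hb := Set.right_mem_Icc.mpr hab
  rcases le_total 0 (f a) with h0 | h0
  · refine ⟨a, ha, fun x hx => ?_, fun x hx => ?_⟩
    · linarith [hmv a ha x ⟨hx.1.le, hx.2⟩ hx.1.le]
    · exact absurd hx.2 (not_lt.mpr hx.1)
  rcases le_total (f b) 0 with h1 | h1
  · refine ⟨b, hb, fun x hx => ?_, fun x hx => ?_⟩
    · exact absurd hx.1 (not_lt.mpr hx.2)
    · linarith [hmv x ⟨hx.1, hx.2.le⟩ b hb hx.2.le]
  obtain ⟨c, hc, hfc0⟩ := intermediate_value_Icc hab hfc ⟨h0, h1⟩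
  refine ⟨c, hc, fun x hx => ?_, fun x hx => ?_⟩
  · linarith [hmv c hc x ⟨hc.1.trans hx.1.le, hx.2⟩ hx.1.le]
  · linarith [hmv x ⟨hx.1, hx.2.le.trans hc.2⟩ c hc hx.2.le]

/-- An integral over an interval is controlled by its values over subintervals avoiding a
neighbourhood of a point. -/
theorem norm_integral_le_of_forall_avoiding {h : ℝ → ℂ} {a b c d K : ℝ} (hc : c ∈ Set.Icc a b)
    (hd : 0 ≤ d) (hK0 : 0 ≤ K) (hi : IntervalIntegrable h volume a b) (h1 : ∀ x, ‖h x‖ ≤ 1)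
    (hK : ∀ u v, a ≤ u → u ≤ v → v ≤ b → (v ≤ c - d ∨ c + d ≤ u) →
      ‖∫ x in u..v, h x‖ ≤ K) :
    ‖∫ x in a..b, h x‖ ≤ 2 * K + 2 * d := by
  obtain ⟨hac, hcb⟩ := hc
  have hii : ∀ u v, a ≤ u → u ≤ b → a ≤ v → v ≤ b → IntervalIntegrable h volume u v :=
    fun u v hu hu' hv hv' => hi.mono_set (by
      rw [Set.uIcc_of_le (hac.trans hcb)]
      exact Set.uIcc_subset_Icc ⟨hu, hu'⟩ ⟨hv, hv'⟩)
  have hm : max a (c - d) ≤ c := max_le hac (by linarith)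
  have hm' : c ≤ min b (c + d) := le_min hcb (by linarith)
  have ham := le_max_left a (c - d)
  have hbm := min_le_left b (c + d)
  have hL : ‖∫ x in a..max a (c - d), h x‖ ≤ K := by
    rcases le_total a (c - d) with h | h
    · rw [max_eq_right h]
      exact hK _ _ le_rfl h (by linarith) (Or.inl le_rfl)
    · simpa [max_eq_left h] using hK0
  have hR : ‖∫ x in min b (c + d)..b, h x‖ ≤ K := by
    rcases le_total b (c + d) with h | h
    · simpa [min_eq_left h] using hK0
    · rw [min_eq_right h]
      exact hK _ _ (by linarith) h le_rfl (Or.inr le_rfl)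
  have hM : ‖∫ x in max a (c - d)..min b (c + d), h x‖ ≤ 2 * d := by
    refine (intervalIntegral.norm_integral_le_of_norm_le_const fun x _ => h1 x).trans ?_
    rw [one_mul, abs_of_nonneg (by linarith)]
    linarith [le_max_right a (c - d), min_le_right b (c + d)]
  rw [← intervalIntegral.integral_add_adjacent_intervals
      (hii a (max a (c - d)) le_rfl (by linarith) ham (by linarith))
      (hii (max a (c - d)) b ham (by linarith) (by linarith) le_rfl),
    ← intervalIntegral.integral_add_adjacent_intervals
      (hii (max a (c - d)) (min b (c + d)) ham (by linarith) (by linarith) hbm)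
      (hii (min b (c + d)) b (by linarith) hbm (by linarith) le_rfl)]
  refine (norm_add_le _ _).trans ?_
  linarith [norm_add_le (∫ x in max a (c - d)..min b (c + d), h x)
    (∫ x in min b (c + d)..b, h x)]

open Complex in
/-- Replacing a phase by its opposite does not change the size of an oscillatory integral. -/
theorem norm_integral_cexp_neg (φ : ℝ → ℝ) (a b : ℝ) :
    ‖∫ x in a..b, cexp (I * ((-φ x : ℝ) : ℂ))‖ = ‖∫ x in a..b, cexp (I * φ x)‖ := by
  rw [← norm_conj (∫ x in a..b, cexp (I * φ x)), ← intervalIntegral.intervalIntegral_conj]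
  congr 2
  funext x
  rw [← exp_conj]
  simp

open Complex in
theorem intervalIntegrable_cexp {φ : ℝ → ℝ} {a b : ℝ} (hab : a ≤ b)
    (hφ : ContinuousOn φ (Set.Icc a b)) :
    IntervalIntegrable (fun x => cexp (I * φ x)) volume a b := by
  apply ContinuousOn.intervalIntegrable
  rw [Set.uIcc_of_le hab]
  fun_prop

open Complex in
/-- Van der Corput's second-derivative test. -/
theorem norm_integral_cexp_le_of_le_deriv_deriv {φ f g : ℝ → ℝ} {a b r : ℝ} (hab : a ≤ b)
    (hr : 0 < r) (hφ : ∀ x ∈ Set.Icc a b, HasDerivAt φ (f x) x)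
    (hf : ∀ x ∈ Set.Icc a b, HasDerivAt f (g x) x) (hg : ContinuousOn g (Set.Icc a b))
    (hgr : ∀ x ∈ Set.Icc a b, r ≤ g x) :
    ‖∫ x in a..b, cexp (I * φ x)‖ ≤ 10 / √r := by
  obtain ⟨c, hc, hc1, hc2⟩ := exists_forall_mul_sub_le_of_le_deriv hab hf hgr
  have hs : 0 < √r := Real.sqrt_pos.mpr hr
  have hrs : r * (1 / √r) = √r := by
    field_simp
    exact (Real.sq_sqrt hr.le).symm
  have hd : 0 < 1 / √r := by positivity
  refine (norm_integral_le_of_forall_avoiding (K := 4 / √r) (d := 1 / √r) hc hd.le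
    (by positivity) (intervalIntegrable_cexp hab fun x hx => (hφ x hx).continuousAt.continuousWithinAt)
    (fun x => (norm_cexp_I_mul_ofReal _).le) fun u v hau huv hvb huvc => ?_).trans
    (le_of_eq (by ring))
  have hsub : Set.Icc u v ⊆ Set.Icc a b := Set.Icc_subset_Icc hau hvb
  refine norm_integral_cexp_le_of_le_abs_deriv huv hs (fun x hx => hφ x (hsub hx))
    (fun x hx => hf x (hsub hx)) (hg.mono hsub) (fun x hx => hr.le.trans (hgr x (hsub hx)))
    fun x hx => ?_
  rcases huvc with h | h
  · have h2 := hc2 x ⟨hau.trans hx.1, by linarith [hx.2]⟩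
    have h3 : r * (1 / √r) ≤ r * (c - x) := by
      gcongr
      linarith [hx.2]
    rw [hrs] at h3
    exact le_abs.mpr (Or.inr (by linarith))
  · have h2 := hc1 x ⟨by linarith [hx.1], hx.2.trans hvb⟩
    have h3 : r * (1 / √r) ≤ r * (x - c) := by
      gcongr
      linarith [hx.1]
    rw [hrs] at h3
    exact le_abs.mpr (Or.inl (by linarith))

open Complex in
/-- Van der Corput's third-derivative test. -/
theorem norm_integral_cexp_le_of_le_deriv_deriv_deriv {φ f g h : ℝ → ℝ} {a b r : ℝ}
    (hab : a ≤ b) (hr : 0 < r) (hφ : ∀ x ∈ Set.Icc a b, HasDerivAt φ (f x) x)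
    (hf : ∀ x ∈ Set.Icc a b, HasDerivAt f (g x) x)
    (hg : ∀ x ∈ Set.Icc a b, HasDerivAt g (h x) x) (hhr : ∀ x ∈ Set.Icc a b, r ^ 3 ≤ h x) :
    ‖∫ x in a..b, cexp (I * φ x)‖ ≤ 22 / r := by
  obtain ⟨c, hc, hc1, hc2⟩ := exists_forall_mul_sub_le_of_le_deriv hab hg hhr
  have hrs : r ^ 3 * (1 / r) = r ^ 2 := by field_simp
  have hgc : ContinuousOn g (Set.Icc a b) := fun x hx => (hg x hx).continuousAt.continuousWithinAt
  have hd : 0 < 1 / r := by positivity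
  refine (norm_integral_le_of_forall_avoiding (K := 10 / r) (d := 1 / r) hc hd.le
    (by positivity) (intervalIntegrable_cexp hab fun x hx => (hφ x hx).continuousAt.continuousWithinAt)
    (fun x => (norm_cexp_I_mul_ofReal _).le) fun u v hau huv hvb huvc => ?_).trans
    (le_of_eq (by ring))
  have hsub : Set.Icc u v ⊆ Set.Icc a b := Set.Icc_subset_Icc hau hvb
  have hr2 : 0 < r ^ 2 := by positivity
  rw [← Real.sqrt_sq hr.le]
  rcases huvc with h | h
  · rw [← norm_integral_cexp_neg]
    refine norm_integral_cexp_le_of_le_deriv_deriv huv hr2 (fun x hx => (hφ x (hsub hx)).fun_neg)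
      (fun x hx => (hf x (hsub hx)).fun_neg) (hgc.mono hsub).neg fun x hx => ?_
    have h2 := hc2 x ⟨hau.trans hx.1, by linarith [hx.2]⟩
    have h3 : r ^ 3 * (1 / r) ≤ r ^ 3 * (c - x) := by
      gcongr
      linarith [hx.2]
    rw [hrs] at h3
    linarith
  · refine norm_integral_cexp_le_of_le_deriv_deriv huv hr2 (fun x hx => hφ x (hsub hx))
      (fun x hx => hf x (hsub hx)) (hgc.mono hsub) fun x hx => ?_
    have h2 := hc1 x ⟨by linarith [hx.1], hx.2.trans hvb⟩
    have h3 : r ^ 3 * (1 / r) ≤ r ^ 3 * (x - c) := by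
      gcongr
      linarith [hx.1]
    rw [hrs] at h3
    linarith

open Complex in
/-- Integration by parts: an amplitude of bounded variation costs its size and its variation. -/
theorem norm_integral_cexp_mul_le {φ A A' w : ℝ → ℝ} {a b K M : ℝ} (hab : a ≤ b)
    (hφ : ContinuousOn φ (Set.Icc a b)) (hA : ∀ x ∈ Set.Icc a b, HasDerivAt A (A' x) x)
    (hA' : ContinuousOn A' (Set.Icc a b)) (hM : |A b| ≤ M)
    (hw : ∀ x ∈ Set.Icc a b, |A' x| ≤ w x) (hwi : IntervalIntegrable w volume a b)
    (hK : ∀ v ∈ Set.Icc a b, ‖∫ x in a..v, cexp (I * φ x)‖ ≤ K) :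
    ‖∫ x in a..b, cexp (I * φ x) * A x‖ ≤ K * (M + ∫ x in a..b, w x) := by
  have hK0 : 0 ≤ K := (norm_nonneg _).trans (hK a (Set.left_mem_Icc.mpr hab))
  have hei := intervalIntegrable_cexp hab hφ
  have hec : ContinuousOn (fun x => cexp (I * φ x)) (Set.Icc a b) := by fun_prop
  have hibp : ∫ x in a..b, cexp (I * φ x) * A x
      = (∫ x in a..b, cexp (I * φ x)) * A b - (∫ x in a..a, cexp (I * φ x)) * A a
        - ∫ v in a..b, (∫ x in a..v, cexp (I * φ x)) * A' v := by
    rw [eq_sub_iff_add_eq, add_comm, ← eq_sub_iff_add_eq]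
    refine intervalIntegral.integral_mul_deriv_eq_deriv_mul_of_hasDerivAt
      (u := fun v => ∫ x in a..v, cexp (I * φ x)) (v := fun x => (A x : ℂ)) ?_ ?_ ?_ ?_ hei ?_
    · exact intervalIntegral.continuousOn_primitive_interval
        (by rwa [Set.uIcc_of_le hab, ← intervalIntegrable_iff_integrableOn_Icc_of_le hab])
    · rw [Set.uIcc_of_le hab]
      exact fun x hx => (hA x hx).ofReal_comp.continuousAt.continuousWithinAt
    · intro x hx
      rw [min_eq_left hab, max_eq_right hab] at hx
      refine intervalIntegral.integral_hasDerivAt_right ?_ ?_ ?_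
      · refine intervalIntegrable_cexp hx.1.le (hφ.mono (Set.Icc_subset_Icc_right hx.2.le))
      · exact (hec.mono Set.Ioo_subset_Icc_self).stronglyMeasurableAtFilter isOpen_Ioo x hx
      · exact hec.continuousAt (Icc_mem_nhds hx.1 hx.2)
    · intro x hx
      rw [min_eq_left hab, max_eq_right hab] at hx
      exact (hA x (Set.Ioo_subset_Icc_self hx)).ofReal_comp
    · apply ContinuousOn.intervalIntegrable
      rw [Set.uIcc_of_le hab]
      fun_prop
  rw [hibp, intervalIntegral.integral_same, zero_mul, sub_zero]
  refine (norm_sub_le _ _).trans ?_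
  rw [mul_add]
  refine add_le_add ?_ ?_
  · rw [norm_mul, norm_real, Real.norm_eq_abs]
    gcongr
    exact hK b (Set.right_mem_Icc.mpr hab)
  · rw [← intervalIntegral.integral_const_mul]
    refine intervalIntegral.norm_integral_le_of_norm_le hab (ae_of_all _ fun x hx => ?_)
      (hwi.const_mul K)
    have hx' := Set.Ioc_subset_Icc_self hx
    rw [norm_mul, norm_real, Real.norm_eq_abs]
    exact mul_le_mul (hK x hx') (hw x hx') (abs_nonneg _) hK0

open Complex in
/-- Real symbols on the line obeying scale-invariant bounds by `C`: the size, the logarithmic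
derivative and the `L¹` norm of the Fourier transform are all controlled. -/
structure IsSymbolBoundedBy (C : ℝ) (ψ : ℝ → ℝ) : Prop where
  contDiff : ContDiff ℝ 1 ψ
  hasCompactSupport : HasCompactSupport ψ
  abs_le (ξ : ℝ) : |ψ ξ| ≤ C
  abs_mul_deriv_le (ξ : ℝ) : |ξ * deriv ψ ξ| ≤ C
  exists_fourier : ∃ ρ : ℝ → ℂ, Integrable ρ ∧ ∫ s, ‖ρ s‖ ≤ C ∧
    ∀ η : ℝ, (ψ η : ℂ) = ∫ s : ℝ, cexp (I * ((2 * π * s * η : ℝ) : ℂ)) * ρ s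

open Complex FourierTransform in
/-- Test functions are symbols with finite bounds. -/
theorem exists_isSymbolBoundedBy {p : ℝ → ℝ} (hp : ContDiff ℝ (⊤ : ℕ∞) p)
    (hc : HasCompactSupport p) : ∃ C, 0 ≤ C ∧ IsSymbolBoundedBy C p := by
  have hp1 : ContDiff ℝ 1 p := hp.of_le (by exact_mod_cast le_top)
  obtain ⟨C₁, hC₁⟩ := hc.exists_bound_of_continuous hp.continuous
  have hd : Continuous fun ξ => ξ * deriv p ξ := by
    have := hp1.continuous_deriv le_rfl
    fun_prop
  obtain ⟨C₂, hC₂⟩ := (hc.deriv.mul_left (f := fun ξ : ℝ => ξ)).exists_bound_of_continuous hd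
  have hcC : HasCompactSupport fun x => (p x : ℂ) := hc.comp_left (g := ((↑) : ℝ → ℂ)) ofReal_zero
  have hpC : ContDiff ℝ (⊤ : ℕ∞) fun x => (p x : ℂ) := ofRealCLM.contDiff.comp hp
  set F : SchwartzMap ℝ ℂ := hcC.toSchwartzMap hpC with hF
  have hFp : (F : ℝ → ℂ) = fun x => (p x : ℂ) := rfl
  have hFi : Integrable (𝓕 (fun x => (p x : ℂ))) := by
    rw [← hFp, ← SchwartzMap.fourier_coe]
    exact (𝓕 F).integrable
  have hpi : Integrable fun x => (p x : ℂ) := by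
    rw [← hFp]
    exact F.integrable
  have hinv := hpC.continuous.fourierInv_fourier_eq hpi hFi
  refine ⟨max (max C₁ C₂) (∫ s, ‖𝓕 (fun x => (p x : ℂ)) s‖), ?_, hp1, hc, fun ξ => ?_,
    fun ξ => ?_, 𝓕 (fun x => (p x : ℂ)), hFi, le_max_right _ _, fun η => ?_⟩
  · exact le_max_of_le_right (integral_nonneg fun _ => norm_nonneg _)
  · exact le_max_of_le_left (le_max_of_le_left (hC₁ ξ))
  · exact le_max_of_le_left (le_max_of_le_right (hC₂ ξ))
  · rw [← congrFun hinv η, Real.fourierInv_eq']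
    refine integral_congr_ae (ae_of_all _ fun s => ?_)
    simp only [smul_eq_mul]
    congr 2
    simp
    ring

namespace IsSymbolBoundedBy

variable {C C₁ C₂ : ℝ} {ψ ψ₁ ψ₂ : ℝ → ℝ}

theorem integrable (h : IsSymbolBoundedBy C ψ) : Integrable ψ :=
  h.contDiff.continuous.integrable_of_hasCompactSupport h.hasCompactSupport

theorem mono (h : IsSymbolBoundedBy C₁ ψ) (hC : C₁ ≤ C₂) : IsSymbolBoundedBy C₂ ψ :=
  ⟨h.contDiff, h.hasCompactSupport, fun ξ => (h.abs_le ξ).trans hC,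
    fun ξ => (h.abs_mul_deriv_le ξ).trans hC,
    let ⟨ρ, h1, h2, h3⟩ := h.exists_fourier
    ⟨ρ, h1, h2.trans hC, h3⟩⟩

theorem comp_mul_left (h : IsSymbolBoundedBy C ψ) {a : ℝ} (ha : 0 < a) :
    IsSymbolBoundedBy C fun ξ => ψ (a * ξ) := by
  obtain ⟨ρ, h1, h2, h3⟩ := h.exists_fourier
  refine ⟨h.contDiff.comp (by fun_prop), ?_, fun ξ => h.abs_le _, fun ξ => ?_,
    fun s => ((a⁻¹ : ℝ) : ℂ) * ρ (a⁻¹ * s), ?_, ?_, fun η => ?_⟩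
  · exact h.hasCompactSupport.comp_homeomorph (Homeomorph.mulLeft₀ a ha.ne')
  · rw [deriv_comp_mul_left, smul_eq_mul]
    convert h.abs_mul_deriv_le (a * ξ) using 2
    ring
  · exact (h1.comp_mul_left' (inv_ne_zero ha.ne')).const_mul _
  · simp_rw [norm_mul, Complex.norm_real, norm_inv, Real.norm_eq_abs, abs_of_pos ha]
    rw [integral_const_mul, Measure.integral_comp_mul_left (fun s => ‖ρ s‖)]
    rw [inv_inv, abs_of_pos ha, smul_eq_mul, inv_mul_cancel_left₀ ha.ne']
    exact h2
  · rw [h3]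
    have := Measure.integral_comp_mul_left (fun s : ℝ =>
      Complex.exp (Complex.I * ((2 * π * s * (a * η) : ℝ) : ℂ)) * ρ s) a⁻¹
    rw [inv_inv, abs_of_pos ha] at this
    rw [eq_comm]
    calc _ = ((a⁻¹ : ℝ) : ℂ) * ∫ s : ℝ,
        Complex.exp (Complex.I * ((2 * π * (a⁻¹ * s) * (a * η) : ℝ) : ℂ)) * ρ (a⁻¹ * s) := by
          rw [← integral_const_mul]
          refine integral_congr_ae (ae_of_all _ fun s => ?_)
          simp only
          rw [show 2 * π * (a⁻¹ * s) * (a * η) = 2 * π * s * η by field_simp]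
          ring
      _ = _ := by
          rw [this, Complex.real_smul, ← mul_assoc, ← Complex.ofReal_mul,
            inv_mul_cancel₀ ha.ne', Complex.ofReal_one, one_mul]

theorem sub (h₁ : IsSymbolBoundedBy C₁ ψ₁) (h₂ : IsSymbolBoundedBy C₂ ψ₂) :
    IsSymbolBoundedBy (C₁ + C₂) fun ξ => ψ₁ ξ - ψ₂ ξ := by
  obtain ⟨ρ₁, h11, h12, h13⟩ := h₁.exists_fourier
  obtain ⟨ρ₂, h21, h22, h23⟩ := h₂.exists_fourier
  have hd₁ := h₁.contDiff.differentiable one_ne_zero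
  have hd₂ := h₂.contDiff.differentiable one_ne_zero
  refine ⟨h₁.contDiff.sub h₂.contDiff, h₁.hasCompactSupport.sub h₂.hasCompactSupport,
    fun ξ => (abs_sub _ _).trans (add_le_add (h₁.abs_le ξ) (h₂.abs_le ξ)), fun ξ => ?_,
    fun s => ρ₁ s - ρ₂ s, h11.sub h21, ?_, fun η => ?_⟩
  · rw [deriv_fun_sub (hd₁ ξ) (hd₂ ξ), mul_sub]
    exact (abs_sub _ _).trans (add_le_add (h₁.abs_mul_deriv_le ξ) (h₂.abs_mul_deriv_le ξ))
  · calc _ ≤ ∫ s, (‖ρ₁ s‖ + ‖ρ₂ s‖) :=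
          integral_mono (h11.sub h21).norm (h11.norm.add h21.norm) fun s => norm_sub_le _ _
      _ ≤ _ := by
          rw [integral_add h11.norm h21.norm]
          exact add_le_add h12 h22
  · have hi : ∀ {ρ : ℝ → ℂ}, Integrable ρ → Integrable fun s : ℝ =>
        Complex.exp (Complex.I * ((2 * π * s * η : ℝ) : ℂ)) * ρ s := fun hρ =>
      hρ.bdd_mul (c := 1) (by fun_prop)
        (ae_of_all _ fun s => (norm_cexp_I_mul_ofReal _).le)
    rw [Complex.ofReal_sub, h13, h23, ← integral_sub (hi h11) (hi h21)]
    simp_rw [mul_sub]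

end IsSymbolBoundedBy

open Complex in
/-- Parseval's identity against a complex Gaussian. -/
theorem integral_cexp_gaussian_mul_eq {ψ : ℝ → ℝ} {ρ : ℝ → ℂ} (hρ : Integrable ρ)
    (hψρ : ∀ η : ℝ, (ψ η : ℂ) = ∫ s : ℝ, cexp (I * ((2 * π * s * η : ℝ) : ℂ)) * ρ s)
    {β : ℂ} (hβ : 0 < β.re) (y : ℝ) :
    ∫ η : ℝ, cexp (I * ((y * η : ℝ) : ℂ)) * cexp (-β * η ^ 2) * ψ η
      = (π / β) ^ (1 / 2 : ℂ) *
        ∫ s : ℝ, cexp (-(((y + 2 * π * s) ^ 2 : ℝ) : ℂ) / (4 * β)) * ρ s := by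
  have hint : Integrable (fun q : ℝ × ℝ => cexp (I * (((y + 2 * π * q.2) * q.1 : ℝ) : ℂ)) *
      (cexp (-β * q.1 ^ 2) * ρ q.2)) (volume.prod volume) := by
    refine ((integrable_cexp_neg_mul_sq hβ).mul_prod hρ).bdd_mul (c := 1)
      (by fun_prop) (ae_of_all _ fun s => (norm_cexp_I_mul_ofReal _).le)
  calc _ = ∫ η : ℝ, ∫ s : ℝ, cexp (I * (((y + 2 * π * s) * η : ℝ) : ℂ)) *
        (cexp (-β * η ^ 2) * ρ s) := by
        refine integral_congr_ae (ae_of_all _ fun η => ?_)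
        simp only
        rw [hψρ, ← integral_const_mul]
        refine integral_congr_ae (ae_of_all _ fun s => ?_)
        simp only
        rw [add_mul, ofReal_add, mul_add, Complex.exp_add]
        ring
    _ = ∫ s : ℝ, ∫ η : ℝ, cexp (I * (((y + 2 * π * s) * η : ℝ) : ℂ)) *
        (cexp (-β * η ^ 2) * ρ s) := integral_integral_swap hint
    _ = _ := by
        rw [← integral_const_mul]
        refine integral_congr_ae (ae_of_all _ fun s => ?_)
        simp only
        have := fourierIntegral_gaussian hβ ((y + 2 * π * s : ℝ) : ℂ)
        rw [ofReal_pow, ← mul_assoc, ← this, ← integral_mul_const]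
        refine integral_congr_ae (ae_of_all _ fun η => ?_)
        simp only
        push_cast
        rw [← mul_assoc, ← mul_assoc]

open Complex in
/-- Parseval's identity against a purely oscillating quadratic phase. -/
theorem integral_cexp_quadratic_mul_eq {ψ : ℝ → ℝ} {ρ : ℝ → ℂ} (hψ : Integrable ψ)
    (hρ : Integrable ρ)
    (hψρ : ∀ η : ℝ, (ψ η : ℂ) = ∫ s : ℝ, cexp (I * ((2 * π * s * η : ℝ) : ℂ)) * ρ s)
    {b : ℝ} (hb : b ≠ 0) (y : ℝ) :
    ∫ η : ℝ, cexp (I * ((y * η + b * η ^ 2 : ℝ) : ℂ)) * ψ η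
      = (π / (-(I * b))) ^ (1 / 2 : ℂ) *
        ∫ s : ℝ, cexp (I * ((-((y + 2 * π * s) ^ 2 / (4 * b)) : ℝ) : ℂ)) * ρ s := by
  have hbC : (b : ℂ) ≠ 0 := ofReal_ne_zero.mpr hb
  have hβ : Tendsto (fun ε : ℝ => (ε : ℂ) - I * b) (nhdsWithin 0 (Set.Ioi 0))
      (nhds (-(I * b))) := by
    have : Continuous fun ε : ℝ => (ε : ℂ) - I * b := by fun_prop
    have h := this.tendsto 0
    rw [ofReal_zero, zero_sub] at h
    exact h.mono_left nhdsWithin_le_nhds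
  have hβ0 : -(I * (b : ℂ)) ≠ 0 := neg_ne_zero.mpr (mul_ne_zero I_ne_zero hbC)
  have hre : ∀ ε : ℝ, ((ε : ℂ) - I * b).re = ε := fun ε => by simp
  have hL : Tendsto (fun ε : ℝ => ∫ η : ℝ, cexp (I * ((y * η : ℝ) : ℂ)) *
      cexp (-((ε : ℂ) - I * b) * η ^ 2) * ψ η) (nhdsWithin 0 (Set.Ioi 0))
      (nhds (∫ η : ℝ, cexp (I * ((y * η : ℝ) : ℂ)) * cexp (-(-(I * b)) * η ^ 2) * ψ η)) := by
    refine tendsto_integral_filter_of_dominated_convergence (fun η => |ψ η|) ?_ ?_ hψ.abs ?_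
    · exact Eventually.of_forall fun ε =>
        AEStronglyMeasurable.mul (by fun_prop) hψ.ofReal.aestronglyMeasurable
    · filter_upwards [self_mem_nhdsWithin] with ε hε
      refine ae_of_all _ fun η => ?_
      rw [norm_mul, norm_mul, norm_cexp_I_mul_ofReal, one_mul, norm_real, Real.norm_eq_abs]
      refine mul_le_of_le_one_left (abs_nonneg _) ?_
      rw [norm_exp, Real.exp_le_one_iff, ← ofReal_pow, re_mul_ofReal, neg_re, hre]
      have := mul_nonneg (le_of_lt hε) (sq_nonneg η)
      linarith
    · exact ae_of_all _ fun η => ((((hβ.neg).mul_const _).cexp).const_mul _).mul_const _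
  have hR : Tendsto (fun ε : ℝ => (π / ((ε : ℂ) - I * b)) ^ (1 / 2 : ℂ) *
      ∫ s : ℝ, cexp (-(((y + 2 * π * s) ^ 2 : ℝ) : ℂ) / (4 * ((ε : ℂ) - I * b))) * ρ s)
      (nhdsWithin 0 (Set.Ioi 0)) (nhds ((π / (-(I * b))) ^ (1 / 2 : ℂ) *
      ∫ s : ℝ, cexp (-(((y + 2 * π * s) ^ 2 : ℝ) : ℂ) / (4 * (-(I * b)))) * ρ s)) := by
    refine Tendsto.mul ?_ ?_
    · have hdiv : Tendsto (fun ε : ℝ => (π : ℂ) / ((ε : ℂ) - I * b)) (nhdsWithin 0 (Set.Ioi 0))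
          (nhds (π / (-(I * b)))) := tendsto_const_nhds.div hβ hβ0
      refine (continuousAt_cpow_const ?_).tendsto.comp hdiv
      have : (π : ℂ) / (-(I * b)) = ((π / b : ℝ) : ℂ) * I := by
        push_cast
        field_simp
        rw [I_sq]
      rw [this, mem_slitPlane_iff]
      right
      simpa using hb
    · refine tendsto_integral_filter_of_dominated_convergence (fun s => ‖ρ s‖) ?_ ?_ hρ.norm ?_
      · exact Eventually.of_forall fun ε =>
          AEStronglyMeasurable.mul (by fun_prop) hρ.aestronglyMeasurable
      · filter_upwards [self_mem_nhdsWithin] with ε hε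
        refine ae_of_all _ fun s => ?_
        rw [norm_mul]
        refine mul_le_of_le_one_left (norm_nonneg _) ?_
        rw [norm_exp, Real.exp_le_one_iff, ← ofReal_neg, div_eq_mul_inv, re_ofReal_mul]
        refine mul_nonpos_of_nonpos_of_nonneg (neg_nonpos.mpr (sq_nonneg _)) ?_
        rw [inv_re]
        refine div_nonneg ?_ (normSq_nonneg _)
        have : (4 * ((ε : ℂ) - I * b)).re = 4 * ε := by simp
        rw [this]
        exact mul_nonneg (by norm_num) (le_of_lt hε)
      · refine ae_of_all _ fun s => Tendsto.mul_const _ (Tendsto.cexp ?_)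
        exact tendsto_const_nhds.div (hβ.const_mul 4) (mul_ne_zero (by norm_num) hβ0)
  have hE : ∀ᶠ ε : ℝ in nhdsWithin 0 (Set.Ioi 0), ∫ η : ℝ, cexp (I * ((y * η : ℝ) : ℂ)) *
      cexp (-((ε : ℂ) - I * b) * η ^ 2) * ψ η = (π / ((ε : ℂ) - I * b)) ^ (1 / 2 : ℂ) *
      ∫ s : ℝ, cexp (-(((y + 2 * π * s) ^ 2 : ℝ) : ℂ) / (4 * ((ε : ℂ) - I * b))) * ρ s := by
    filter_upwards [self_mem_nhdsWithin] with ε hε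
    exact integral_cexp_gaussian_mul_eq hρ hψρ (by rw [hre]; exact hε) y
  have := tendsto_nhds_unique (hL.congr' hE) hR
  refine (integral_congr_ae (ae_of_all _ fun η => ?_)).trans
    (this.trans (congrArg _ (integral_congr_ae (ae_of_all _ fun s => ?_))))
  · rw [← Complex.exp_add]
    congr 2
    push_cast
    ring
  · change cexp _ * ρ s = cexp _ * ρ s
    congr 2
    push_cast
    field_simp
    rw [I_sq]
    ring

open Complex in
/-- Decay of an oscillatory integral with phase `x ξ + τ³ ξ³ - E / ξ` over an interval away from
the origin. -/
theorem norm_intervalIntegral_cexp_cubic_mul_le {A A' : ℝ → ℝ} {M τ E a b : ℝ} (hab : a ≤ b)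
    (h1 : ∀ ξ ∈ Set.Icc a b, 1 ≤ |ξ|) (hA : ∀ ξ, 1 ≤ |ξ| → HasDerivAt A (A' ξ) ξ)
    (hA' : ContinuousOn A' {0}ᶜ) (hM0 : 0 ≤ M) (hM : ∀ ξ, |A ξ| ≤ M)
    (hM' : ∀ ξ, 1 ≤ |ξ| → |A' ξ| ≤ M * (1 + ξ ^ 2)⁻¹) (hτ : 0 < τ) (hE : 0 ≤ E) (x : ℝ) :
    ‖∫ ξ in a..b, cexp (I * ((x * ξ + τ ^ 3 * ξ ^ 3 - E / ξ : ℝ) : ℂ)) * A ξ‖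
      ≤ 22 / τ * (M + M * π) := by
  have hne : ∀ ξ ∈ Set.Icc a b, ξ ≠ 0 := fun ξ hξ h => by
    have := h1 ξ hξ
    rw [h, abs_zero] at this
    linarith
  have hd1 : ∀ ξ ∈ Set.Icc a b, HasDerivAt (fun ξ => x * ξ + τ ^ 3 * ξ ^ 3 - E / ξ)
      (x + 3 * τ ^ 3 * ξ ^ 2 + E / ξ ^ 2) ξ := fun ξ hξ => by
    have h0 := hne ξ hξ
    refine ((((hasDerivAt_id' ξ).const_mul x).fun_add (((hasDerivAt_id' ξ).fun_pow 3).const_mul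
      (τ ^ 3))).fun_sub ((hasDerivAt_const ξ E).fun_div (hasDerivAt_id' ξ) h0)).congr_deriv ?_
    field_simp
    push_cast
    ring
  have hd2 : ∀ ξ ∈ Set.Icc a b, HasDerivAt (fun ξ => x + 3 * τ ^ 3 * ξ ^ 2 + E / ξ ^ 2)
      (6 * τ ^ 3 * ξ - 2 * E / ξ ^ 3) ξ := fun ξ hξ => by
    have h0 := hne ξ hξ
    refine (((hasDerivAt_const ξ x).fun_add (((hasDerivAt_id' ξ).fun_pow 2).const_mul
      (3 * τ ^ 3))).fun_add ((hasDerivAt_const ξ E).fun_div ((hasDerivAt_id' ξ).fun_pow 2)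
        (pow_ne_zero 2 h0))).congr_deriv ?_
    field_simp
    push_cast
    ring
  have hd3 : ∀ ξ ∈ Set.Icc a b, HasDerivAt (fun ξ => 6 * τ ^ 3 * ξ - 2 * E / ξ ^ 3)
      (6 * τ ^ 3 + 6 * E / ξ ^ 4) ξ := fun ξ hξ => by
    have h0 := hne ξ hξ
    refine (((hasDerivAt_id' ξ).const_mul (6 * τ ^ 3)).fun_sub
      ((hasDerivAt_const ξ (2 * E)).fun_div ((hasDerivAt_id' ξ).fun_pow 3)
        (pow_ne_zero 3 h0))).congr_deriv ?_
    field_simp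
    push_cast
    ring
  have hlow : ∀ ξ : ℝ, τ ^ 3 ≤ 6 * τ ^ 3 + 6 * E / ξ ^ 4 := fun ξ => by
    have h1 : 0 ≤ 6 * E / ξ ^ 4 := by positivity
    have h2 : 0 < τ ^ 3 := by positivity
    linarith
  have hint : ∀ u v : ℝ, IntervalIntegrable (fun ξ : ℝ => M * (1 + ξ ^ 2)⁻¹) volume u v :=
    fun u v => (integrable_inv_one_add_sq.const_mul M).intervalIntegrable
  refine (norm_integral_cexp_mul_le (w := fun ξ => M * (1 + ξ ^ 2)⁻¹) (K := 22 / τ) (M := M) hab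
    (fun ξ hξ => (hd1 ξ hξ).continuousAt.continuousWithinAt) (fun ξ hξ => hA ξ (h1 ξ hξ))
    (hA'.mono fun ξ hξ => hne ξ hξ) (hM b) (fun ξ hξ => hM' ξ (h1 ξ hξ)) (hint a b)
    fun v hv => ?_).trans ?_
  · have hsub : Set.Icc a v ⊆ Set.Icc a b := Set.Icc_subset_Icc_right hv.2
    exact norm_integral_cexp_le_of_le_deriv_deriv_deriv hv.1 hτ (fun ξ hξ => hd1 ξ (hsub hξ))
      (fun ξ hξ => hd2 ξ (hsub hξ)) (fun ξ hξ => hd3 ξ (hsub hξ)) fun ξ _ => hlow ξ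
  · rw [intervalIntegral.integral_const_mul, integral_inv_one_add_sq]
    gcongr
    linarith [arctan_lt_pi_div_two b, neg_pi_div_two_lt_arctan a]

open Complex in
theorem integrable_cexp_mul {α : Type*} [MeasurableSpace α] {μ : Measure α} {φ : α → ℝ}
    {F : α → ℂ} (hφ : Measurable φ) (hF : Integrable F μ) :
    Integrable (fun a => cexp (I * φ a) * F a) μ :=
  hF.bdd_mul (c := 1) (Measurable.aestronglyMeasurable (by fun_prop))
    (ae_of_all _ fun _ => (norm_cexp_I_mul_ofReal _).le)

open Complex in
theorem norm_integral_cexp_cubic_mul_le {A A' : ℝ → ℝ} {M τ E : ℝ} (hAi : Integrable A)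
    (hAs : HasCompactSupport A) (hA0 : ∀ ξ, |ξ| ≤ 1 → A ξ = 0)
    (hA : ∀ ξ, 1 ≤ |ξ| → HasDerivAt A (A' ξ) ξ)
    (hA' : ContinuousOn A' {0}ᶜ) (hM : ∀ ξ, |A ξ| ≤ M)
    (hM' : ∀ ξ, 1 ≤ |ξ| → |A' ξ| ≤ M * (1 + ξ ^ 2)⁻¹) (hτ : 0 < τ) (hE : 0 ≤ E) (x : ℝ) :
    ‖∫ ξ : ℝ, cexp (I * ((x * ξ + τ ^ 3 * ξ ^ 3 - E / ξ : ℝ) : ℂ)) * A ξ‖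
      ≤ 44 / τ * (M + M * π) := by
  have hM0 : 0 ≤ M := (abs_nonneg _).trans (hM 0)
  obtain ⟨R, hR⟩ := hAs.isCompact.isBounded.subset_ball 0
  set B := max 1 R with hB
  have hB1 : 1 ≤ B := le_max_left _ _
  have hi : ∀ u v : ℝ, IntervalIntegrable (fun ξ : ℝ =>
      cexp (I * ((x * ξ + τ ^ 3 * ξ ^ 3 - E / ξ : ℝ) : ℂ)) * A ξ) volume u v := fun u v =>
    (integrable_cexp_mul (by fun_prop) hAi.ofReal).intervalIntegrable
  have hsupp : Function.support (fun ξ : ℝ =>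
      cexp (I * ((x * ξ + τ ^ 3 * ξ ^ 3 - E / ξ : ℝ) : ℂ)) * A ξ) ⊆ Set.Ioc (-B) B := by
    intro ξ hξ
    have h1 : A ξ ≠ 0 := fun h => hξ (by simp [h])
    have h2 := hR (subset_tsupport A h1)
    rw [mem_ball_zero_iff, Real.norm_eq_abs] at h2
    have h3 := abs_lt.mp (h2.trans_le (le_max_right 1 R))
    exact ⟨h3.1, h3.2.le⟩
  have hmid : ∫ ξ in (-1)..1, cexp (I * ((x * ξ + τ ^ 3 * ξ ^ 3 - E / ξ : ℝ) : ℂ)) * A ξ = 0 := by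
    refine intervalIntegral.integral_zero_ae (ae_of_all _ fun ξ hξ => ?_)
    rw [Set.uIoc_of_le (by norm_num)] at hξ
    rw [hA0 ξ (abs_le.mpr ⟨hξ.1.le, hξ.2⟩), ofReal_zero, mul_zero]
  rw [← intervalIntegral.integral_eq_integral_of_support_subset hsupp,
    ← intervalIntegral.integral_add_adjacent_intervals (hi (-B) (-1)) (hi (-1) B),
    ← intervalIntegral.integral_add_adjacent_intervals (hi (-1) 1) (hi 1 B), hmid, zero_add]
  refine (norm_add_le _ _).trans ?_
  have hl := norm_intervalIntegral_cexp_cubic_mul_le (a := -B) (b := -1) (by linarith)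
    (fun ξ hξ => by rw [le_abs]; right; linarith [hξ.2]) hA hA' hM0 hM hM' hτ hE x
  have hr := norm_intervalIntegral_cexp_cubic_mul_le (a := 1) (b := B) hB1
    (fun ξ hξ => by rw [le_abs]; left; linarith [hξ.1]) hA hA' hM0 hM hM' hτ hE x
  rw [show 44 / τ * (M + M * π) = 22 / τ * (M + M * π) + 22 / τ * (M + M * π) by ring]
  exact add_le_add hl hr

open Complex in
/-- Uniform decay of the cubic oscillatory integral with a symbol divided by `ξ` and cut off away
from the origin. -/
theorem norm_integral_cexp_cubic_symbol_le {ψ p : ℝ → ℝ} {C D τ E : ℝ}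
    (hψ : IsSymbolBoundedBy C ψ) (hp : IsSymbolBoundedBy D p) (hp1 : ∀ ξ, |ξ| ≤ 1 → p ξ = 1)
    (hτ : 0 < τ) (hE : 0 ≤ E) (x : ℝ) :
    Integrable (fun ξ => ψ ξ * (1 - p ξ) / ξ) ∧
    ‖∫ ξ : ℝ, cexp (I * ((x * ξ + τ ^ 3 * ξ ^ 3 - E / ξ : ℝ) : ℂ)) *
      ((ψ ξ * (1 - p ξ) / ξ : ℝ) : ℂ)‖ ≤ 264 * C * (1 + D) * (1 + π) / τ := by
  have hC0 : 0 ≤ C := (abs_nonneg _).trans (hψ.abs_le 0)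
  have hD0 : 0 ≤ D := (abs_nonneg _).trans (hp.abs_le 0)
  have hψc := hψ.contDiff.continuous
  have hpc := hp.contDiff.continuous
  have hψd := hψ.contDiff.continuous_deriv le_rfl
  have hpd := hp.contDiff.continuous_deriv le_rfl
  have hne : ∀ ξ : ℝ, 1 ≤ |ξ| → ξ ≠ 0 := fun ξ hξ => abs_pos.mp (by linarith)
  have hA0 : ∀ ξ : ℝ, |ξ| ≤ 1 → ψ ξ * (1 - p ξ) / ξ = 0 := fun ξ hξ => by simp [hp1 ξ hξ]
  have h1p : ∀ ξ, |1 - p ξ| ≤ 1 + D := fun ξ =>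
    (abs_sub _ _).trans (by rw [abs_one]; linarith [hp.abs_le ξ])
  have hnum : ∀ ξ, |ψ ξ * (1 - p ξ)| ≤ C * (1 + D) := fun ξ => by
    rw [abs_mul]
    exact mul_le_mul (hψ.abs_le ξ) (h1p ξ) (abs_nonneg _) hC0
  have hCD : 0 ≤ C * (1 + D) := by positivity
  have hbound : ∀ ξ : ℝ, |ψ ξ * (1 - p ξ) / ξ| ≤ |ψ ξ * (1 - p ξ)| := fun ξ => by
    rcases le_total |ξ| 1 with h | h
    · simp [hp1 ξ h]
    · rw [abs_div]
      exact div_le_self (abs_nonneg _) h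
  have hcs : HasCompactSupport fun ξ => ψ ξ * (1 - p ξ) := hψ.hasCompactSupport.mul_right
  have hAi : Integrable fun ξ => ψ ξ * (1 - p ξ) / ξ := by
    have hni : Integrable fun ξ => ψ ξ * (1 - p ξ) :=
      (hψc.mul (continuous_const.sub hpc)).integrable_of_hasCompactSupport hcs
    refine hni.mono (Measurable.aestronglyMeasurable ?_) (ae_of_all _ hbound)
    have := hψc.measurable
    have := hpc.measurable
    fun_prop
  refine ⟨hAi, (norm_integral_cexp_cubic_mul_le (M := 6 * (C * (1 + D)))
    (A' := fun ξ => (deriv ψ ξ * (1 - p ξ) - ψ ξ * deriv p ξ) / ξ - ψ ξ * (1 - p ξ) / ξ ^ 2)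
    hAi ?_ hA0 (fun ξ hξ => ?_) ?_ (fun ξ => ?_) (fun ξ hξ => ?_) hτ hE x).trans
    (le_of_eq (by ring))⟩
  · simp_rw [div_eq_mul_inv]
    exact hcs.mul_right
  · have h0 := hne ξ hξ
    have d1 := (hψ.contDiff.differentiable one_ne_zero ξ).hasDerivAt
    have d2 := (hp.contDiff.differentiable one_ne_zero ξ).hasDerivAt
    refine ((d1.fun_mul (d2.const_sub 1)).fun_div (hasDerivAt_id' ξ) h0).congr_deriv ?_
    field_simp
    ring
  · have : ∀ ξ ∈ ({0}ᶜ : Set ℝ), ξ ≠ 0 := fun ξ hξ => hξ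
    have h2 : ∀ ξ ∈ ({0}ᶜ : Set ℝ), ξ ^ 2 ≠ 0 := fun ξ hξ => pow_ne_zero 2 hξ
    fun_prop (disch := assumption)
  · linarith [hbound ξ, hnum ξ]
  · have h0 := hne ξ hξ
    have hsq : 1 ≤ ξ ^ 2 := by rw [← sq_abs]; nlinarith
    have e1 : |ξ * deriv ψ ξ * (1 - p ξ)| ≤ C * (1 + D) := by
      rw [abs_mul]
      exact mul_le_mul (hψ.abs_mul_deriv_le ξ) (h1p ξ) (abs_nonneg _) hC0
    have e2 : |ψ ξ * (ξ * deriv p ξ)| ≤ C * D := by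
      rw [abs_mul]
      exact mul_le_mul (hψ.abs_le ξ) (hp.abs_mul_deriv_le ξ) (abs_nonneg _) hC0
    have e3 := hnum ξ
    rw [show (deriv ψ ξ * (1 - p ξ) - ψ ξ * deriv p ξ) / ξ - ψ ξ * (1 - p ξ) / ξ ^ 2
      = (ξ * deriv ψ ξ * (1 - p ξ) - ψ ξ * (ξ * deriv p ξ) - ψ ξ * (1 - p ξ)) / ξ ^ 2 by
        field_simp, abs_div, abs_of_pos (by linarith : 0 < ξ ^ 2), ← div_eq_mul_inv,
        div_le_div_iff₀ (by linarith) (by linarith)]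
    have e4 : |ξ * deriv ψ ξ * (1 - p ξ) - ψ ξ * (ξ * deriv p ξ) - ψ ξ * (1 - p ξ)|
        ≤ 3 * (C * (1 + D)) := by
      rw [abs_le] at *
      constructor <;> linarith
    calc _ ≤ 3 * (C * (1 + D)) * (1 + ξ ^ 2) := by gcongr
      _ ≤ 3 * (C * (1 + D)) * (2 * ξ ^ 2) := by gcongr; linarith
      _ = _ := by ring

open Complex in
/-- Integrating out the two transversal frequencies by Parseval turns the three-dimensional kernel
into a superposition of one-dimensional cubic oscillatory integrals. -/
theorem oscI_eq_integral {Ψ ψ₂ ψ₃ : ℝ → ℝ} {ρ₂ ρ₃ : ℝ → ℂ} (hΨ : Integrable Ψ)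
    (hΨ' : Integrable fun ξ => Ψ ξ / ξ) (h₂ : Integrable ψ₂) (h₃ : Integrable ψ₃)
    (hρ₂ : Integrable ρ₂) (hρ₃ : Integrable ρ₃)
    (hψρ₂ : ∀ η : ℝ, (ψ₂ η : ℂ) = ∫ s : ℝ, cexp (I * ((2 * π * s * η : ℝ) : ℂ)) * ρ₂ s)
    (hψρ₃ : ∀ η : ℝ, (ψ₃ η : ℂ) = ∫ s : ℝ, cexp (I * ((2 * π * s * η : ℝ) : ℂ)) * ρ₃ s)
    {t : ℝ} (ht : 0 < t) (x : ℝ × ℝ × ℝ) :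
    oscI Ψ ψ₂ ψ₃ t x = I * π / t * ∫ s : ℝ × ℝ,
      (∫ ξ : ℝ, cexp (I * ((x.1 * ξ + t * ξ ^ 3 -
        ((x.2.1 + 2 * π * s.1) ^ 2 + (x.2.2 + 2 * π * s.2) ^ 2) / (4 * t) / ξ : ℝ) : ℂ)) *
          ((Ψ ξ / ξ : ℝ) : ℂ)) * (ρ₂ s.1 * ρ₃ s.2) := by
  have hmeas : ∀ ξ : ℝ × ℝ × ℝ, dot3 x ξ + t * omega3 ξ = (x.1 * ξ.1 + t * ξ.1 ^ 3) +
      ((x.2.1 * ξ.2.1 + t * ξ.1 * ξ.2.1 ^ 2) + (x.2.2 * ξ.2.2 + t * ξ.1 * ξ.2.2 ^ 2)) := by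
    intro ξ
    simp only [dot3, omega3]
    ring
  have hint : Integrable (fun ξ : ℝ × ℝ × ℝ =>
      cexp (I * ((dot3 x ξ + t * omega3 ξ : ℝ) : ℂ)) *
        ((Ψ ξ.1 * ψ₂ ξ.2.1 * ψ₃ ξ.2.2 : ℝ) : ℂ)) (volume.prod volume) := by
    refine integrable_cexp_mul ?_ ?_
    · simp only [hmeas]
      fun_prop
    · simp_rw [mul_assoc]
      exact (hΨ.mul_prod (h₂.mul_prod h₃)).ofReal
  have hswap : Integrable (fun q : ℝ × ℝ × ℝ => cexp (I * ((x.1 * q.1 + t * q.1 ^ 3 -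
        ((x.2.1 + 2 * π * q.2.1) ^ 2 + (x.2.2 + 2 * π * q.2.2) ^ 2) / (4 * t) / q.1 : ℝ) : ℂ)) *
          (((Ψ q.1 / q.1 : ℝ) : ℂ) * (ρ₂ q.2.1 * ρ₃ q.2.2))) (volume.prod volume) :=
    integrable_cexp_mul (by fun_prop) (hΨ'.ofReal.mul_prod (hρ₂.mul_prod hρ₃))
  have hξ : ∀ ξ : ℝ, ξ ≠ 0 → ∫ q : ℝ × ℝ,
      cexp (I * ((dot3 x (ξ, q) + t * omega3 (ξ, q) : ℝ) : ℂ)) *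
        ((Ψ ξ * ψ₂ q.1 * ψ₃ q.2 : ℝ) : ℂ) = I * π / t * ∫ s : ℝ × ℝ,
      cexp (I * ((x.1 * ξ + t * ξ ^ 3 -
        ((x.2.1 + 2 * π * s.1) ^ 2 + (x.2.2 + 2 * π * s.2) ^ 2) / (4 * t) / ξ : ℝ) : ℂ)) *
          (((Ψ ξ / ξ : ℝ) : ℂ) * (ρ₂ s.1 * ρ₃ s.2)) := by
    intro ξ h0
    have hb : t * ξ ≠ 0 := mul_ne_zero ht.ne' h0
    have hξC : (ξ : ℂ) ≠ 0 := ofReal_ne_zero.mpr h0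
    have htC : (t : ℂ) ≠ 0 := ofReal_ne_zero.mpr ht.ne'
    calc _ = cexp (I * ((x.1 * ξ + t * ξ ^ 3 : ℝ) : ℂ)) * Ψ ξ *
          ∫ q : ℝ × ℝ, (cexp (I * ((x.2.1 * q.1 + t * ξ * q.1 ^ 2 : ℝ) : ℂ)) * ψ₂ q.1) *
            (cexp (I * ((x.2.2 * q.2 + t * ξ * q.2 ^ 2 : ℝ) : ℂ)) * ψ₃ q.2) := by
          rw [← integral_const_mul]
          refine integral_congr_ae (ae_of_all _ fun q => ?_)
          simp only [hmeas]
          rw [ofReal_add, ofReal_add (x.2.1 * q.1 + _), mul_add, mul_add, Complex.exp_add,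
            Complex.exp_add, ofReal_mul, ofReal_mul]
          ring
      _ = cexp (I * ((x.1 * ξ + t * ξ ^ 3 : ℝ) : ℂ)) * Ψ ξ * ((π / (-(I * ((t * ξ : ℝ) : ℂ)))) *
          ∫ s : ℝ × ℝ,
            (cexp (I * ((-((x.2.1 + 2 * π * s.1) ^ 2 / (4 * (t * ξ))) : ℝ) : ℂ)) * ρ₂ s.1) *
            (cexp (I * ((-((x.2.2 + 2 * π * s.2) ^ 2 / (4 * (t * ξ))) : ℝ) : ℂ)) * ρ₃ s.2)) := by
          congr 1
          rw [Measure.volume_eq_prod,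
            integral_prod_mul
              (fun η : ℝ => cexp (I * ((x.2.1 * η + t * ξ * η ^ 2 : ℝ) : ℂ)) * (ψ₂ η : ℂ))
              (fun η : ℝ => cexp (I * ((x.2.2 * η + t * ξ * η ^ 2 : ℝ) : ℂ)) * (ψ₃ η : ℂ)),
            integral_prod_mul
              (fun s : ℝ => cexp (I * ((-((x.2.1 + 2 * π * s) ^ 2 / (4 * (t * ξ))) : ℝ) : ℂ)) * ρ₂ s)
              (fun s : ℝ => cexp (I * ((-((x.2.2 + 2 * π * s) ^ 2 / (4 * (t * ξ))) : ℝ) : ℂ)) * ρ₃ s),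
            integral_cexp_quadratic_mul_eq h₂ hρ₂ hψρ₂ hb,
            integral_cexp_quadratic_mul_eq h₃ hρ₃ hψρ₃ hb, mul_mul_mul_comm, ← sq,
            one_div, show (2 : ℂ) = ((2 : ℕ) : ℂ) by norm_num, cpow_nat_inv_pow _ two_ne_zero]
      _ = _ := by
          rw [mul_left_comm, ← mul_assoc, ← integral_const_mul, ← integral_const_mul]
          refine integral_congr_ae (ae_of_all _ fun s => ?_)
          simp only
          have he : x.1 * ξ + t * ξ ^ 3 -
              ((x.2.1 + 2 * π * s.1) ^ 2 + (x.2.2 + 2 * π * s.2) ^ 2) / (4 * t) / ξ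
              = (x.1 * ξ + t * ξ ^ 3) + (-((x.2.1 + 2 * π * s.1) ^ 2 / (4 * (t * ξ))) +
                -((x.2.2 + 2 * π * s.2) ^ 2 / (4 * (t * ξ)))) := by
            field_simp
            ring
          have hc : (π : ℂ) / (-(I * ((t * ξ : ℝ) : ℂ))) * Ψ ξ
              = I * π / t * ((Ψ ξ / ξ : ℝ) : ℂ) := by
            push_cast
            field_simp
            rw [I_sq]
            ring
          rw [he, ofReal_add (x.1 * ξ + t * ξ ^ 3), ofReal_add (-_), mul_add, mul_add,
            Complex.exp_add, Complex.exp_add]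
          linear_combination (cexp (I * ((x.1 * ξ + t * ξ ^ 3 : ℝ) : ℂ)) *
            cexp (I * ((-((x.2.1 + 2 * π * s.1) ^ 2 / (4 * (t * ξ))) : ℝ) : ℂ)) *
            cexp (I * ((-((x.2.2 + 2 * π * s.2) ^ 2 / (4 * (t * ξ))) : ℝ) : ℂ)) *
            (ρ₂ s.1 * ρ₃ s.2)) * hc
  rw [oscI, Measure.volume_eq_prod, integral_prod _ hint]
  calc _ = ∫ ξ : ℝ, I * π / t * ∫ s : ℝ × ℝ,
      cexp (I * ((x.1 * ξ + t * ξ ^ 3 -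
        ((x.2.1 + 2 * π * s.1) ^ 2 + (x.2.2 + 2 * π * s.2) ^ 2) / (4 * t) / ξ : ℝ) : ℂ)) *
          (((Ψ ξ / ξ : ℝ) : ℂ) * (ρ₂ s.1 * ρ₃ s.2)) := by
        refine integral_congr_ae ?_
        filter_upwards [Measure.ae_ne volume (0 : ℝ)] with ξ h0
        exact hξ ξ h0
    _ = _ := by
        rw [integral_const_mul, integral_integral_swap hswap]
        congr 1
        refine integral_congr_ae (ae_of_all _ fun s => ?_)
        simp only
        rw [← integral_mul_const]
        simp_rw [mul_assoc]

open Complex in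
/-- Decay of the kernel whose symbol is a product of scale-invariantly bounded symbols, cut off
away from `ξ = 0`. -/
theorem norm_oscI_le {ψ₁ ψ₂ ψ₃ p : ℝ → ℝ} {C D : ℝ} (h₁ : IsSymbolBoundedBy C ψ₁)
    (h₂ : IsSymbolBoundedBy C ψ₂) (h₃ : IsSymbolBoundedBy C ψ₃) (hp : IsSymbolBoundedBy D p)
    (hp1 : ∀ ξ, |ξ| ≤ 1 → p ξ = 1) {t : ℝ} (ht : 0 < t) (x : ℝ × ℝ × ℝ) :
    ‖oscI (fun a => ψ₁ a * (1 - p a)) ψ₂ ψ₃ t x‖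
      ≤ 264 * π * (1 + π) * C ^ 3 * (1 + D) * t ^ (-(4 : ℝ) / 3) := by
  have hC0 : 0 ≤ C := (abs_nonneg _).trans (h₁.abs_le 0)
  have hD0 : 0 ≤ D := (abs_nonneg _).trans (hp.abs_le 0)
  obtain ⟨ρ₂, hρ₂, hC₂, hψρ₂⟩ := h₂.exists_fourier
  obtain ⟨ρ₃, hρ₃, hC₃, hψρ₃⟩ := h₃.exists_fourier
  set τ : ℝ := t ^ ((1 : ℝ) / 3) with hτdef
  have hτ : 0 < τ := Real.rpow_pos_of_pos ht _
  have hτ3 : τ ^ 3 = t := by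
    rw [hτdef, ← Real.rpow_natCast, ← Real.rpow_mul ht.le]
    norm_num
  have hdecay := fun (E : ℝ) (hE : 0 ≤ E) =>
    norm_integral_cexp_cubic_symbol_le h₁ hp hp1 hτ hE x.1
  have hΨ : Integrable fun a => ψ₁ a * (1 - p a) :=
    (h₁.contDiff.continuous.mul (continuous_const.sub hp.contDiff.continuous))
      |>.integrable_of_hasCompactSupport h₁.hasCompactSupport.mul_right
  rw [oscI_eq_integral hΨ (hdecay 0 le_rfl).1 h₂.integrable h₃.integrable hρ₂ hρ₃ hψρ₂ hψρ₃ ht,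
    norm_mul]
  have hpre : ‖I * (π : ℂ) / t‖ = π / t := by
    rw [norm_div, norm_mul, norm_I, norm_real, norm_real, Real.norm_eq_abs, Real.norm_eq_abs,
      abs_of_pos pi_pos, abs_of_pos ht, one_mul]
  set K := 264 * C * (1 + D) * (1 + π) / τ with hK
  have hK0 : 0 ≤ K := by positivity
  have hI : ‖∫ s : ℝ × ℝ, (∫ ξ : ℝ, cexp (I * ((x.1 * ξ + t * ξ ^ 3 -
        ((x.2.1 + 2 * π * s.1) ^ 2 + (x.2.2 + 2 * π * s.2) ^ 2) / (4 * t) / ξ : ℝ) : ℂ)) *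
          ((ψ₁ ξ * (1 - p ξ) / ξ : ℝ) : ℂ)) * (ρ₂ s.1 * ρ₃ s.2)‖ ≤ K * (C * C) := by
    calc _ ≤ ∫ s : ℝ × ℝ, K * (‖ρ₂ s.1‖ * ‖ρ₃ s.2‖) := by
          refine norm_integral_le_of_norm_le ((hρ₂.norm.mul_prod hρ₃.norm).const_mul K)
            (ae_of_all _ fun s => ?_)
          rw [norm_mul, norm_mul]
          refine mul_le_mul_of_nonneg_right ?_ (by positivity)
          have := (hdecay (((x.2.1 + 2 * π * s.1) ^ 2 + (x.2.2 + 2 * π * s.2) ^ 2) / (4 * t))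
            (by positivity)).2
          rwa [hτ3] at this
      _ ≤ K * (C * C) := by
          rw [integral_const_mul, Measure.volume_eq_prod,
            integral_prod_mul (fun s => ‖ρ₂ s‖) (fun s => ‖ρ₃ s‖)]
          gcongr
  rw [hpre]
  refine (mul_le_mul_of_nonneg_left hI (by positivity)).trans (le_of_eq ?_)
  have hpow : t ^ (-(4 : ℝ) / 3) = 1 / (t * τ) := by
    rw [show -(4 : ℝ) / 3 = -(1 + 1 / 3) by norm_num, Real.rpow_neg ht.le, Real.rpow_add ht,
      Real.rpow_one, one_div (t * τ)]
  rw [hpow, hK]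
  field_simp

theorem IsSymbolBoundedBy.pk1 {C : ℝ} {p : ℝ → ℝ} (hp : IsSymbolBoundedBy C p) (k : ℤ) :
    IsSymbolBoundedBy C (pk1 p k) :=
  hp.comp_mul_left (by positivity)

theorem IsSymbolBoundedBy.dk1 {C : ℝ} {p : ℝ → ℝ} (hp : IsSymbolBoundedBy C p) (k : ℤ) :
    IsSymbolBoundedBy (C + C) (dk1 p k) :=
  (hp.comp_mul_left (by positivity)).sub (hp.comp_mul_left (by positivity))

/-- Uniform time decay of the high-frequency part of the localized kernel:
|I_k^1(t,x̄)| ≤ C t^{-4/3} for t ∈ (0,1], uniformly in k ≥ 0 and x̄ ∈ ℝ³. -/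
theorem Ik1_decay
    (p : ℝ → ℝ) (hp_smooth : ContDiff ℝ (⊤ : ℕ∞) p) (hp_nonneg : ∀ ξ, 0 ≤ p ξ)
    (hp_one : ∀ ξ : ℝ, |ξ| ≤ 1 → p ξ = 1) (hp_zero : ∀ ξ : ℝ, 2 ≤ |ξ| → p ξ = 0) :
    ∃ C : ℝ, 0 < C ∧ ∀ k : ℕ, ∀ ψ₁ ψ₂ ψ₃ : ℝ → ℝ,
      ((ψ₁, ψ₂, ψ₃) = (dk1 p k, pk1 p k, pk1 p k) ∨
       (ψ₁, ψ₂, ψ₃) = (pk1 p k, dk1 p k, pk1 p k) ∨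
       (ψ₁, ψ₂, ψ₃) = (pk1 p k, pk1 p k, dk1 p k)) →
      ∀ t : ℝ, 0 < t → t ≤ 1 → ∀ x : ℝ × ℝ × ℝ,
        ‖oscI (fun a => ψ₁ a * (1 - p a)) ψ₂ ψ₃ t x‖ ≤ C * t ^ (-(4:ℝ)/3) := by
  have hc : HasCompactSupport p := by
    refine HasCompactSupport.intro (isCompact_Icc (a := -2) (b := 2)) fun ξ hξ => hp_zero ξ ?_
    by_contra h
    exact hξ (abs_le.mp (not_le.mp h).le)
  obtain ⟨C, hC0, hC⟩ := exists_isSymbolBoundedBy hp_smooth hc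
  have hCpos : 0 < C := lt_of_lt_of_le one_pos (by simpa [hp_one 0 (by simp)] using hC.abs_le 0)
  have hpos := pi_pos
  refine ⟨264 * π * (1 + π) * (C + C) ^ 3 * (1 + C), by positivity,
    fun k ψ₁ ψ₂ ψ₃ hψ t ht _ x => ?_⟩
  have hd := hC.dk1 k
  have hk := (hC.pk1 k).mono (le_add_of_nonneg_left hC0 : C ≤ C + C)
  simp only [Prod.mk.injEq] at hψ
  rcases hψ with ⟨rfl, rfl, rfl⟩ | ⟨rfl, rfl, rfl⟩ | ⟨rfl, rfl, rfl⟩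
  · exact norm_oscI_le hd hk hk hC hp_one ht x
  · exact norm_oscI_le hk hd hk hC hp_one ht x
  · exact norm_oscI_le hk hk hd hC hp_one ht x
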